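/- Let r = (r₁,…,rₙ) ∈ R_n and y = (y₁,…,yₙ) ∈ ℝⁿ. Then the following three statements are equivalent: (i) y ∈ Bad(r); (ii) there exists c > 0 such that for every Q ≥ 1 the only integer solution (q, p₁,…,pₙ) of the system |q| < Q and |q yᵢ − pᵢ| < (c Q⁻¹)^{rᵢ} for 1 ≤ i ≤ n is q = p₁ = ⋯ = pₙ = 0; (iii) there exists c > 0 such that for every H ≥ 1 the only integer solution (a₀, a₁,…,aₙ) of the system |a₀ + a₁y₁ + ⋯ + aₙyₙ| < c H⁻¹ and |aᵢ| < H^{rᵢ} for 1 ≤ i ≤ n is a₀ = a₁ = ⋯ = aₙ = 0. -/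

import Mathlib

/-- Distance from a real number to the nearest integer. -/
noncomputable def distNearestInt (x : ℝ) : ℝ := ⨅ p : ℤ, |x - (p : ℝ)|

/-- `badPow ρ x = x ^ (1/ρ)`, with the convention `x ^ (1/0) = 0`. -/
noncomputable def badPow (ρ x : ℝ) : ℝ := if ρ = 0 then 0 else x ^ (1 / ρ)

/-- The set `R_n` of weight vectors: nonnegative components summing to `1`. -/
def Weights (n : ℕ) : Set (Fin n → ℝ) := {r | (∑ i, r i) = 1 ∧ ∀ i, 0 ≤ r i}

/-- The set `Bad(r)` of `r`-badly approximable points of `ℝⁿ`. -/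
def BadSet {n : ℕ} (r : Fin n → ℝ) : Set (Fin n → ℝ) :=
  {y | ∃ c > 0, ∀ q : ℕ, 1 ≤ q →
    ∃ i, c * (q : ℝ)⁻¹ ≤ badPow (r i) (distNearestInt (q * y i))}

/-- Minkowski's linear forms theorem (strict version). -/
theorem minkowski_forms {ι : Type*} [Fintype ι] [DecidableEq ι] (A : Matrix ι ι ℝ)
    (hA : A.det ≠ 0) (t : ι → ℝ) (ht : ∀ i, 0 < t i) (h : |A.det| < ∏ i, t i) :
    ∃ x : ι → ℤ, x ≠ 0 ∧ ∀ i, |(A.mulVec (fun j => (x j : ℝ))) i| < t i := by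
  let b := Pi.basisFun ℝ ι
  have : Countable (Submodule.span ℤ (Set.range b)).toAddSubgroup :=
    inferInstanceAs (Countable (Submodule.span ℤ (Set.range b)))
  have fund := ZSpan.isAddFundamentalDomain' b (MeasureTheory.volume : MeasureTheory.Measure (ι → ℝ))
  let box : Set (ι → ℝ) := Set.univ.pi fun i => Set.Ioo (-t i) (t i)
  let f := Matrix.toLin' A
  have hdet : LinearMap.det f = A.det := LinearMap.det_toLin' A
  have hvol : MeasureTheory.volume box = ENNReal.ofReal (∏ i, (2 * t i)) := by
    rw [Real.volume_pi_Ioo, ENNReal.ofReal_prod_of_nonneg]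
    · congr 1; ext i; congr 1; ring
    · intro i _; linarith [ht i]
  have hF : MeasureTheory.volume (ZSpan.fundamentalDomain b) = 1 := by
    rw [ZSpan.volume_fundamentalDomain]
    have : Matrix.of (⇑b) = 1 := by
      ext i j; simp [b, Matrix.one_apply, Pi.single_apply, eq_comm]
    rw [this]; simp
  have key : MeasureTheory.volume (ZSpan.fundamentalDomain b) * 2 ^ Module.finrank ℝ (ι → ℝ)
      < MeasureTheory.volume (f ⁻¹' box) := by
    rw [hF, MeasureTheory.Measure.addHaar_preimage_linearMap _ (by rw [hdet]; exact hA), hdet, hvol,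
      ← ENNReal.ofReal_mul (abs_nonneg _), Module.finrank_fintype_fun_eq_card, one_mul]
    have e : (2 : ENNReal) ^ Fintype.card ι = ENNReal.ofReal (2 ^ Fintype.card ι) := by
      rw [ENNReal.ofReal_pow (by norm_num)]; simp
    have hp : 0 < |A.det| := abs_pos.mpr hA
    have h3 : (2:ℝ) ^ Fintype.card ι < |A.det⁻¹| * ∏ i, (2 * t i) := by
      rw [Finset.prod_mul_distrib, Finset.prod_const, Finset.card_univ, abs_inv,
        mul_left_comm]
      have : 1 < |A.det|⁻¹ * ∏ i, t i := by
        rw [inv_mul_eq_div, one_lt_div hp]; exact h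
      have h2 : (0:ℝ) < 2 ^ Fintype.card ι := by positivity
      nlinarith
    rw [e]
    exact (ENNReal.ofReal_lt_ofReal_iff (lt_trans (by positivity) h3)).2 h3
  have hconv : Convex ℝ (f ⁻¹' box) :=
    (convex_pi fun i _ => convex_Ioo _ _).linear_preimage f
  have hsymm : ∀ x ∈ f ⁻¹' box, -x ∈ f ⁻¹' box := by
    intro x hx i hi
    have := hx i hi
    simp only [map_neg, Pi.neg_apply, Set.mem_Ioo] at this ⊢
    constructor <;> linarith [this.1, this.2]
  obtain ⟨x, hx0, hx⟩ := MeasureTheory.exists_ne_zero_mem_lattice_of_measure_mul_two_pow_lt_measure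
    fund hsymm hconv key
  have hz : ∀ i, ∃ z : ℤ, (z : ℝ) = (x : ι → ℝ) i := by
    intro i
    have := (b.mem_span_iff_repr_mem ℤ (x : ι → ℝ)).mp x.2 i
    simpa [b] using this
  choose z hz using hz
  refine ⟨z, ?_, ?_⟩
  · rintro rfl
    apply hx0
    ext i
    simp [← hz]
  · intro i
    have h1 := hx i (Set.mem_univ i)
    have : (fun j => (z j : ℝ)) = (x : ι → ℝ) := funext hz
    rw [this, abs_lt]
    simpa [f] using h1

/-- Mahler-type transference. -/
theorem transfer {ι : Type*} [Fintype ι] [DecidableEq ι] (B B' : Matrix ι ι ℝ)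
    (hB : |B.det| = 1) (hBB : B'.transpose * B = 1) (g : ι → ℝ) (hg : ∀ i, 0 < g i)
    (hprod : ∏ i, g i = 1) (δ ε : ℝ) (hδ : 0 < δ) (hε : 0 < ε)
    (hδε : δ < ε ^ (Fintype.card ι - 1)) (z : ι → ℤ) (hz : z ≠ 0)
    (hM : ∀ i, |B'.mulVec (fun j => (z j : ℝ)) i| ≤ δ * g i) :
    ∃ x : ι → ℤ, x ≠ 0 ∧
      ∀ i, |B.mulVec (fun j => (x j : ℝ)) i| ≤ Fintype.card ι * ε / g i := by
  set M := B'.mulVec (fun j => (z j : ℝ)) with hMdef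
  have hne : Nonempty ι := by
    by_contra hc
    rw [not_nonempty_iff] at hc
    exact hz (Subsingleton.elim _ _)
  have hM0 : M ≠ 0 := by
    intro h0
    have h1 : B.transpose * B' = 1 := by
      have := congrArg Matrix.transpose hBB
      simpa [Matrix.transpose_mul] using this
    have h2 : B.transpose.mulVec M = (fun j => (z j : ℝ)) := by
      rw [hMdef, Matrix.mulVec_mulVec, h1, Matrix.one_mulVec]
    rw [h0, Matrix.mulVec_zero] at h2
    apply hz
    ext j
    have := congrFun h2 j
    simp only [Pi.zero_apply] at this
    exact_mod_cast this.symm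
  obtain ⟨k, -, hk⟩ := Finset.exists_max_image Finset.univ (fun i => |M i| / g i)
    Finset.univ_nonempty
  have hMk : 0 < |M k| := by
    obtain ⟨j, hj⟩ := Function.ne_iff.mp hM0
    have h1 : 0 < |M j| / g j := div_pos (abs_pos.mpr hj) (hg j)
    have h2 := lt_of_lt_of_le h1 (hk j (Finset.mem_univ _))
    by_contra hc
    have : |M k| = 0 := le_antisymm (not_lt.mp hc) (abs_nonneg _)
    simp [this] at h2
  let U : Matrix ι ι ℝ := (1 : Matrix ι ι ℝ).updateRow k M
  have hU : U.det = M k := by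
    have : U.det = ((1 : Matrix ι ι ℝ).updateCol k M).det := by
      rw [← Matrix.det_transpose, ← Matrix.updateCol_transpose, Matrix.transpose_one]
    rw [this, ← Matrix.cramer_apply, Matrix.cramer_one]; rfl
  have hdet : |(U * B).det| = |M k| := by
    rw [Matrix.det_mul, abs_mul, hB, mul_one, hU]
  let t : ι → ℝ := Function.update (fun i => ε / g i) k 1
  have ht : ∀ i, 0 < t i := by
    intro i
    by_cases h : i = k
    · subst h; simp [t]
    · simp [t, h, div_pos hε (hg i)]
  have htp : ∏ i, t i = ε ^ (Fintype.card ι - 1) * g k := by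
    rw [Finset.prod_update_of_mem (Finset.mem_univ _), one_mul, Finset.prod_div_distrib,
      Finset.prod_const, Finset.card_sdiff_of_subset (by simp), Finset.card_univ,
      Finset.card_singleton]
    have : g k * ∏ i ∈ Finset.univ \ {k}, g i = 1 := by
      rw [← hprod, ← Finset.mul_prod_erase Finset.univ g (Finset.mem_univ k),
        Finset.sdiff_singleton_eq_erase]
    have h2 : ∏ i ∈ Finset.univ \ {k}, g i ≠ 0 := by
      intro h0; rw [h0] at this; simp at this
    rw [div_eq_iff h2, mul_assoc, this, mul_one]
  have hlt : |(U * B).det| < ∏ i, t i := by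
    rw [hdet, htp]
    exact lt_of_le_of_lt (hM k) (mul_lt_mul_of_pos_right hδε (hg k))
  obtain ⟨x, hx0, hx⟩ := minkowski_forms (U * B) (by
    intro h0; rw [h0] at hdet; simp at hdet; simp [← hdet] at hMk) t ht hlt
  refine ⟨x, hx0, ?_⟩
  set w := B.mulVec (fun j => (x j : ℝ)) with hw
  have hdot : M ⬝ᵥ w = ((∑ i, z i * x i : ℤ) : ℝ) := by
    rw [hMdef, hw, Matrix.dotProduct_mulVec, ← Matrix.vecMul_transpose, Matrix.vecMul_vecMul, hBB,
      Matrix.vecMul_one]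
    simp [dotProduct]
  have hrow : ∀ i, (U * B).mulVec (fun j => (x j : ℝ)) i = U i ⬝ᵥ w := by
    intro i; rw [← Matrix.mulVec_mulVec]; rfl
  have hI : M ⬝ᵥ w = 0 := by
    have h1 := hx k
    rw [hrow] at h1
    have h2 : U k = M := by simp [U]
    rw [h2, hdot] at h1
    simp only [t, Function.update_self] at h1
    rw [hdot]
    have h3 : |∑ i, z i * x i| < 1 := by exact_mod_cast h1
    rw [Int.abs_lt_one_iff.mp h3]; simp
  have hj : ∀ j, j ≠ k → |w j| < ε / g j := by
    intro j hjk
    have h1 := hx j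
    rw [hrow] at h1
    have h2 : U j = (1 : Matrix ι ι ℝ) j := by simp [U, hjk]
    rw [h2] at h1
    have h3 : (1 : Matrix ι ι ℝ) j ⬝ᵥ w = w j := congrFun (Matrix.one_mulVec w) j
    rw [h3] at h1
    simpa [t, hjk] using h1
  have hcard : (1 : ℝ) ≤ Fintype.card ι := by exact_mod_cast Fintype.card_pos
  intro i
  by_cases hik : i = k
  · subst hik
    have h1 : M i * w i = -∑ j ∈ Finset.univ.erase i, M j * w j := by
      have := Finset.add_sum_erase Finset.univ (fun j => M j * w j) (Finset.mem_univ i)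
      have h2 : ∑ j, M j * w j = 0 := hI
      linarith
    have h2 : |M i| * |w i| ≤ Fintype.card ι * (|M i| / g i * ε) := by
      rw [← abs_mul, h1, abs_neg]
      refine (Finset.abs_sum_le_sum_abs _ _).trans ?_
      refine (Finset.sum_le_card_nsmul _ _ (|M i| / g i * ε) ?_).trans ?_
      · intro j hj'
        have h3 := (hj j (Finset.ne_of_mem_erase hj')).le
        have h4 := hk j (Finset.mem_univ _)
        rw [abs_mul]
        have h5 : |M j| ≤ |M i| / g i * g j := (div_le_iff₀ (hg j)).mp h4
        calc |M j| * |w j| ≤ (|M i| / g i * g j) * (ε / g j) :=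
              mul_le_mul h5 h3 (abs_nonneg _) ((abs_nonneg _).trans h5)
          _ = _ := by have := (hg j).ne'; field_simp
      · rw [nsmul_eq_mul]
        have h6 : ((Finset.univ.erase i).card : ℝ) ≤ Fintype.card ι := by
          exact_mod_cast Finset.card_le_univ _
        exact mul_le_mul_of_nonneg_right h6 (by have := hg i; positivity)
    have h7 : Fintype.card ι * (|M i| / g i * ε) = |M i| * (Fintype.card ι * ε / g i) := by ring
    rw [h7] at h2
    exact le_of_mul_le_mul_left h2 hMk
  · refine (hj i hik).le.trans ?_
    have := hg i
    gcongr
    nlinarith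

/-- The forms `q`, `q yᵢ - pᵢ`. -/
noncomputable def formL {S : Type*} [DecidableEq S] (y : S → ℝ) :
    Matrix (Unit ⊕ S) (Unit ⊕ S) ℝ :=
  Matrix.fromBlocks 1 0 (Matrix.of fun i _ => y i) (-1)

/-- The forms `a₀ + ∑ aᵢ yᵢ`, `-aᵢ`. -/
noncomputable def formM {S : Type*} [DecidableEq S] (y : S → ℝ) :
    Matrix (Unit ⊕ S) (Unit ⊕ S) ℝ :=
  Matrix.fromBlocks 1 (Matrix.of fun _ i => y i) 0 (-1)

section forms
variable {S : Type*} [Fintype S] [DecidableEq S] (y : S → ℝ)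

theorem formL_det : |(formL y).det| = 1 := by
  rw [formL, Matrix.det_fromBlocks_zero₁₂]; simp [Matrix.det_neg]

theorem formM_det : |(formM y).det| = 1 := by
  rw [formM, Matrix.det_fromBlocks_zero₂₁]; simp [Matrix.det_neg]

theorem formML : (formM y).transpose * formL y = 1 := by
  rw [formM, formL, Matrix.fromBlocks_transpose, Matrix.fromBlocks_multiply,
    ← Matrix.fromBlocks_one]
  congr 1 <;> simp
  ext i j; simp

theorem formLM : (formL y).transpose * formM y = 1 := by
  have := congrArg Matrix.transpose (formML y)
  simpa [Matrix.transpose_mul] using this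

theorem formL_inl (v : Unit ⊕ S → ℝ) : (formL y).mulVec v (Sum.inl ()) = v (Sum.inl ()) := by
  simp [formL, Matrix.mulVec, dotProduct, Fintype.sum_sum_type]

theorem formL_inr (v : Unit ⊕ S → ℝ) (i : S) :
    (formL y).mulVec v (Sum.inr i) = v (Sum.inl ()) * y i - v (Sum.inr i) := by
  simp [formL, Matrix.mulVec, dotProduct, Fintype.sum_sum_type, Matrix.one_apply]
  ring

theorem formM_inl (v : Unit ⊕ S → ℝ) :
    (formM y).mulVec v (Sum.inl ()) = v (Sum.inl ()) + ∑ i, v (Sum.inr i) * y i := by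
  simp [formM, Matrix.mulVec, dotProduct, Fintype.sum_sum_type, mul_comm]

theorem formM_inr (v : Unit ⊕ S → ℝ) (i : S) :
    (formM y).mulVec v (Sum.inr i) = - v (Sum.inr i) := by
  simp [formM, Matrix.mulVec, dotProduct, Fintype.sum_sum_type, Matrix.one_apply]

/-- From a small value of the dual form to a good simultaneous approximation. -/
theorem transfer_ML (r : S → ℝ) (hr : ∑ i, r i = 1) (δ ε H : ℝ) (hδ : 0 < δ) (hε : 0 < ε)
    (hH : 0 < H) (hδε : δ < ε ^ Fintype.card S) (a₀ : ℤ) (a : S → ℤ)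
    (hne : ¬ (a₀ = 0 ∧ ∀ i, a i = 0))
    (h0 : |(a₀ : ℝ) + ∑ i, (a i : ℝ) * y i| ≤ δ * H⁻¹)
    (h1 : ∀ i, |(a i : ℝ)| ≤ δ * H ^ r i) :
    ∃ (q : ℤ) (p : S → ℤ), ¬ (q = 0 ∧ ∀ i, p i = 0) ∧
      |(q : ℝ)| ≤ (Fintype.card S + 1) * ε * H ∧
      ∀ i, |(q : ℝ) * y i - p i| ≤ (Fintype.card S + 1) * ε / H ^ r i := by
  obtain ⟨x, hx0, hx⟩ := transfer (formL y) (formM y) (formL_det y) (formML y)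
    (Sum.elim (fun _ => H⁻¹) (fun i => H ^ r i))
    (by rintro (i | i) <;> simp <;> positivity)
    (by
      rw [Fintype.prod_sum_type]
      simp only [Sum.elim_inl, Sum.elim_inr, Finset.prod_const, Finset.univ_unique,
        Finset.card_singleton, pow_one]
      rw [← Real.rpow_sum_of_pos hH, hr, Real.rpow_one, inv_mul_cancel₀ hH.ne'])
    δ ε hδ hε (by simpa using hδε) (Sum.elim (fun _ => a₀) a)
    (by
      intro h
      exact hne ⟨congrFun h (Sum.inl ()), fun i => congrFun h (Sum.inr i)⟩)
    (by
      rintro (i | i)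
      · rw [show i = () from rfl, formM_inl]; simpa using h0
      · rw [formM_inr]; simpa using h1 i)
  refine ⟨x (Sum.inl ()), fun i => x (Sum.inr i), ?_, ?_, ?_⟩
  · rintro ⟨h, h'⟩
    apply hx0
    ext (i | i)
    · exact h
    · exact h' i
  · have := hx (Sum.inl ())
    rw [formL_inl] at this
    simpa [add_comm] using this
  · intro i
    have := hx (Sum.inr i)
    rw [formL_inr] at this
    simpa [add_comm] using this

/-- From a good simultaneous approximation to a small value of the dual form. -/
theorem transfer_LM (r : S → ℝ) (hr : ∑ i, r i = 1) (δ ε H : ℝ) (hδ : 0 < δ) (hε : 0 < ε)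
    (hH : 0 < H) (hδε : δ < ε ^ Fintype.card S) (q : ℤ) (p : S → ℤ)
    (hne : ¬ (q = 0 ∧ ∀ i, p i = 0))
    (h0 : |(q : ℝ)| ≤ δ * H)
    (h1 : ∀ i, |(q : ℝ) * y i - p i| ≤ δ * (H ^ r i)⁻¹) :
    ∃ (a₀ : ℤ) (a : S → ℤ), ¬ (a₀ = 0 ∧ ∀ i, a i = 0) ∧
      |(a₀ : ℝ) + ∑ i, (a i : ℝ) * y i| ≤ (Fintype.card S + 1) * ε / H ∧
      ∀ i, |(a i : ℝ)| ≤ (Fintype.card S + 1) * ε * H ^ r i := by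
  obtain ⟨x, hx0, hx⟩ := transfer (formM y) (formL y) (formM_det y) (formLM y)
    (Sum.elim (fun _ => H) (fun i => (H ^ r i)⁻¹))
    (by rintro (i | i) <;> simp <;> positivity)
    (by
      rw [Fintype.prod_sum_type]
      simp only [Sum.elim_inl, Sum.elim_inr, Finset.prod_const, Finset.univ_unique,
        Finset.card_singleton, pow_one, Finset.prod_inv_distrib]
      rw [← Real.rpow_sum_of_pos hH, hr, Real.rpow_one, mul_inv_cancel₀ hH.ne'])
    δ ε hδ hε (by simpa using hδε) (Sum.elim (fun _ => q) p)
    (by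
      intro h
      exact hne ⟨congrFun h (Sum.inl ()), fun i => congrFun h (Sum.inr i)⟩)
    (by
      rintro (i | i)
      · rw [show i = () from rfl, formL_inl]; simpa using h0
      · rw [formL_inr]; simpa using h1 i)
  refine ⟨x (Sum.inl ()), fun i => x (Sum.inr i), ?_, ?_, ?_⟩
  · rintro ⟨h, h'⟩
    apply hx0
    ext (i | i)
    · exact h
    · exact h' i
  · have := hx (Sum.inl ())
    rw [formM_inl] at this
    simpa [add_comm] using this
  · intro i
    have := hx (Sum.inr i)
    rw [formM_inr] at this
    simpa [add_comm] using this

end forms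

theorem int_zero_of_abs_lt_one {p : ℤ} (h : |(p : ℝ)| < 1) : p = 0 := by
  have : |p| < 1 := by exact_mod_cast h
  exact Int.abs_lt_one_iff.mp this

theorem min_le_rpow {c ρ : ℝ} (hc : 0 < c) (h0 : 0 ≤ ρ) (h1 : ρ ≤ 1) : min 1 c ≤ c ^ ρ := by
  have hm : 0 < min 1 c := lt_min one_pos hc
  calc min 1 c = (min 1 c) ^ (1:ℝ) := (Real.rpow_one _).symm
    _ ≤ (min 1 c) ^ ρ := Real.rpow_le_rpow_of_exponent_ge hm (min_le_left _ _) h1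
    _ ≤ c ^ ρ := Real.rpow_le_rpow hm.le (min_le_right _ _) h0

theorem distNearestInt_eq (x : ℝ) : distNearestInt x = |x - round x| := by
  apply le_antisymm
  · exact ciInf_le ⟨0, by rintro _ ⟨p, rfl⟩; exact abs_nonneg _⟩ (round x)
  · exact le_ciInf fun p => round_le x p

theorem distNearestInt_le (x : ℝ) (p : ℤ) : distNearestInt x ≤ |x - p| := by
  rw [distNearestInt_eq]; exact round_le x p

/-- Condition (ii). -/
def CondII {n : ℕ} (r y : Fin n → ℝ) : Prop :=
  ∃ c : ℝ, 0 < c ∧ ∀ Q : ℝ, 1 ≤ Q → ∀ (q : ℤ) (p : Fin n → ℤ),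
        |(q : ℝ)| < Q → (∀ i, |(q : ℝ) * y i - (p i : ℝ)| < (c * Q⁻¹) ^ (r i)) →
        q = 0 ∧ ∀ i, p i = 0

/-- Condition (iii). -/
def CondIII {n : ℕ} (r y : Fin n → ℝ) : Prop :=
  ∃ c : ℝ, 0 < c ∧ ∀ H : ℝ, 1 ≤ H → ∀ (a₀ : ℤ) (a : Fin n → ℤ),
        |(a₀ : ℝ) + ∑ i, (a i : ℝ) * y i| < c * H⁻¹ → (∀ i, |(a i : ℝ)| < H ^ (r i)) →
        a₀ = 0 ∧ ∀ i, a i = 0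

theorem zero_case {n : ℕ} {r y : Fin n → ℝ} (h0 : ∀ i, 0 ≤ r i) {c Q : ℝ} (hc : 0 < c)
    (hc1 : c ≤ 1) (hQ : 1 ≤ Q) {q : ℤ} {p : Fin n → ℤ} (hq : q = 0)
    (hp : ∀ i, |(q : ℝ) * y i - (p i : ℝ)| < (c * Q⁻¹) ^ (r i)) (i : Fin n) : p i = 0 := by
  subst hq
  apply int_zero_of_abs_lt_one
  have h1 := hp i
  simp only [Int.cast_zero, zero_mul, zero_sub, abs_neg] at h1
  refine lt_of_lt_of_le h1 (Real.rpow_le_one (by positivity) ?_ (h0 i))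
  have : Q⁻¹ ≤ 1 := inv_le_one_of_one_le₀ hQ
  have : 0 < Q⁻¹ := by positivity
  nlinarith

theorem bad_imp_II {n : ℕ} {r : Fin n → ℝ} (h0 : ∀ i, 0 ≤ r i) {y : Fin n → ℝ}
    (h : y ∈ BadSet r) : CondII r y := by
  obtain ⟨c, hc, h⟩ := h
  refine ⟨min 1 c, lt_min one_pos hc, fun Q hQ q p hq hp => ?_⟩
  have hm : 0 < min 1 c := lt_min one_pos hc
  by_cases hq0 : q = 0
  · exact ⟨hq0, zero_case h0 hm (min_le_left _ _) hQ hq0 hp⟩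
  exfalso
  obtain ⟨i, hi⟩ := h q.natAbs (Int.natAbs_pos.mpr hq0)
  have hqa : ((q.natAbs : ℕ) : ℝ) = |(q : ℝ)| := by
    rw [← Int.cast_abs, Int.abs_eq_natAbs]; simp
  have hqpos : 0 < |(q : ℝ)| := abs_pos.mpr (by exact_mod_cast hq0)
  rw [hqa] at hi
  have hcq : 0 < c * |(q : ℝ)|⁻¹ := by positivity
  have hr : r i ≠ 0 := by
    intro hr
    rw [badPow, if_pos hr] at hi
    linarith
  have hrp : 0 < r i := lt_of_le_of_ne (h0 i) (Ne.symm hr)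
  rw [badPow, if_neg hr] at hi
  have hd : distNearestInt (|(q : ℝ)| * y i) ≤ |(q : ℝ) * y i - p i| := by
    rcases abs_choice (q : ℝ) with e | e <;> rw [e]
    · exact distNearestInt_le _ _
    · refine (distNearestInt_le _ (-(p i))).trans (le_of_eq ?_)
      rw [← abs_neg]; congr 1; push_cast; ring
  have hdn : 0 ≤ distNearestInt (|(q : ℝ)| * y i) := by
    rw [distNearestInt_eq]; exact abs_nonneg _
  have h1 : (c * |(q : ℝ)|⁻¹) ^ r i ≤ distNearestInt (|(q : ℝ)| * y i) := by
    have := Real.rpow_le_rpow hcq.le hi hrp.le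
    rwa [← Real.rpow_mul hdn, one_div, inv_mul_cancel₀ hr, Real.rpow_one] at this
  have h2 : (min 1 c * Q⁻¹) ^ r i ≤ (c * |(q : ℝ)|⁻¹) ^ r i := by
    apply Real.rpow_le_rpow (by positivity) _ hrp.le
    have : Q⁻¹ ≤ |(q : ℝ)|⁻¹ := inv_anti₀ hqpos hq.le
    exact mul_le_mul (min_le_right _ _) this (by positivity) hc.le
  linarith [hp i]

theorem II_imp_bad {n : ℕ} {r : Fin n → ℝ} (h0 : ∀ i, 0 ≤ r i) {y : Fin n → ℝ}
    (h : CondII r y) : y ∈ BadSet r := by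
  obtain ⟨c, hc, h⟩ := h
  refine ⟨c / 2, by positivity, fun q hq => ?_⟩
  have hq1 : (1 : ℝ) ≤ q := by exact_mod_cast hq
  by_contra! hcon
  have := (h (2 * q) (by linarith) q (fun i => round ((q : ℝ) * y i))
    (by simp only [Int.cast_natCast]; rw [abs_of_nonneg] <;> linarith) ?_).1
  · omega
  intro i
  have h1 := hcon i
  simp only [Int.cast_natCast]
  have hb := abs_sub_round ((q : ℝ) * y i)
  have e : c / 2 * (q : ℝ)⁻¹ = c * (2 * (q : ℝ))⁻¹ := by
    rw [mul_inv]; ring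
  by_cases hr : r i = 0
  · rw [hr, Real.rpow_zero]; linarith
  · have hrp : 0 < r i := lt_of_le_of_ne (h0 i) (Ne.symm hr)
    rw [badPow, if_neg hr, distNearestInt_eq, e] at h1
    have := Real.rpow_lt_rpow (by positivity) h1 hrp
    rwa [← Real.rpow_mul (abs_nonneg _), one_div, inv_mul_cancel₀ hr, Real.rpow_one] at this

theorem II_imp_III {n : ℕ} {r : Fin n → ℝ} (hs : ∑ i, r i = 1) (h0 : ∀ i, 0 ≤ r i)
    {y : Fin n → ℝ} (h : CondII r y) : CondIII r y := by
  obtain ⟨c, hc, h⟩ := h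
  have hr1 : ∀ i, r i ≤ 1 := fun i => by
    rw [← hs]; exact Finset.single_le_sum (fun j _ => h0 j) (Finset.mem_univ i)
  have hm : 0 < min 1 c := lt_min one_pos hc
  obtain ⟨ε, hε, hεm⟩ : ∃ ε : ℝ, 0 < ε ∧ ((n : ℝ) + 1) * ε < min 1 c := by
    refine ⟨min 1 c / (2 * (n + 1)), by positivity, ?_⟩
    have : ((n : ℝ) + 1) * (min 1 c / (2 * (n + 1))) = min 1 c / 2 := by
      have : (n : ℝ) + 1 ≠ 0 := by positivity
      field_simp
    linarith
  obtain ⟨δ, hδ, hδε⟩ := exists_between (pow_pos hε n)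
  obtain ⟨K, hK1, hK⟩ : ∃ K : ℝ, 1 ≤ K ∧ ∀ i, r i ≠ 0 → 1 ≤ δ * K ^ r i := by
    have : ∀ᶠ K : ℝ in Filter.atTop, ∀ i, r i ≠ 0 → 1 ≤ δ * K ^ r i := by
      rw [Filter.eventually_all]
      intro i
      by_cases hr : r i = 0
      · simp [hr]
      · have hrp : 0 < r i := lt_of_le_of_ne (h0 i) (Ne.symm hr)
        filter_upwards [(tendsto_rpow_atTop hrp).eventually_ge_atTop (1 / δ)] with K hK _
        rw [div_le_iff₀ hδ] at hK
        linarith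
    obtain ⟨K, h1, h2⟩ := ((Filter.eventually_ge_atTop (1:ℝ)).and this).exists
    exact ⟨K, h1, h2⟩
  have hK0 : 0 < K := by linarith
  refine ⟨δ / K, by positivity, fun H hH a₀ a ha0 ha => ?_⟩
  by_contra hne
  have hH0 : 0 < H := by linarith
  have hKH : 0 < K * H := by positivity
  obtain ⟨q, p, hqp, hq, hp⟩ := transfer_ML y r hs δ ε (K * H) hδ hε hKH (by simpa using hδε)
    a₀ a hne (by
      refine ha0.le.trans (le_of_eq ?_)
      rw [mul_inv]; ring) (by
      intro i
      by_cases hr : r i = 0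
      · have h1 := ha i
        rw [hr, Real.rpow_zero] at h1
        rw [int_zero_of_abs_lt_one h1]
        simp only [Int.cast_zero, abs_zero]
        positivity
      · rw [Real.mul_rpow hK0.le hH0.le, ← mul_assoc]
        refine (ha i).le.trans ?_
        exact le_mul_of_one_le_left (by positivity) (hK i hr))
  rw [Fintype.card_fin] at hq hp
  apply hqp
  refine h (K * H) (by nlinarith) q p ?_ ?_
  · refine lt_of_le_of_lt hq ?_
    have : ((n : ℝ) + 1) * ε < 1 := lt_of_lt_of_le hεm (min_le_left _ _)
    nlinarith
  · intro i
    refine lt_of_le_of_lt (hp i) ?_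
    rw [Real.mul_rpow hc.le (by positivity), Real.inv_rpow hKH.le, ← div_eq_mul_inv]
    have : 0 < (K * H) ^ r i := by positivity
    gcongr
    exact lt_of_lt_of_le hεm (min_le_rpow hc (h0 i) (hr1 i))

theorem III_imp_II {n : ℕ} {r : Fin n → ℝ} (hs : ∑ i, r i = 1) (h0 : ∀ i, 0 ≤ r i)
    {y : Fin n → ℝ} (h : CondIII r y) : CondII r y := by
  obtain ⟨c, hc, h⟩ := h
  have hm : 0 < min 1 c := lt_min one_pos hc
  have hsum : ∀ f : Fin n → ℝ, (∀ i, r i = 0 → f i = 0) →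
      ∑ i : {i // r i ≠ 0}, f i = ∑ i, f i := by
    intro f hf
    rw [← Fintype.sum_subtype_add_sum_subtype (fun i => r i ≠ 0) f]
    have : ∑ i : {i // ¬ r i ≠ 0}, f i = 0 :=
      Finset.sum_eq_zero fun i _ => hf i (not_not.mp i.2)
    rw [this, add_zero]
  set s := Fintype.card {i // r i ≠ 0} with hsdef
  obtain ⟨ε, hε, hεm⟩ : ∃ ε : ℝ, 0 < ε ∧ ((s : ℝ) + 1) * ε < min 1 c := by
    refine ⟨min 1 c / (2 * (s + 1)), by positivity, ?_⟩
    have : ((s : ℝ) + 1) * (min 1 c / (2 * (s + 1))) = min 1 c / 2 := by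
      have : (s : ℝ) + 1 ≠ 0 := by positivity
      field_simp
    linarith
  obtain ⟨δ, hδ, hδε⟩ := exists_between (lt_min one_pos (pow_pos hε s))
  have hδ1 : δ < 1 := lt_of_lt_of_le hδε (min_le_left _ _)
  have hδs : δ < ε ^ s := lt_of_lt_of_le hδε (min_le_right _ _)
  obtain ⟨b, hb0, hb1, hb⟩ : ∃ b : ℝ, 0 < b ∧ b ≤ 1 ∧ ∀ i, r i ≠ 0 → b ^ r i ≤ δ := by
    have : ∀ᶠ K : ℝ in Filter.atTop, ∀ i, r i ≠ 0 → 1 / δ ≤ K ^ r i := by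
      rw [Filter.eventually_all]
      intro i
      by_cases hr : r i = 0
      · simp [hr]
      · have hrp : 0 < r i := lt_of_le_of_ne (h0 i) (Ne.symm hr)
        filter_upwards [(tendsto_rpow_atTop hrp).eventually_ge_atTop (1 / δ)] with K hK _
        exact hK
    obtain ⟨K, h1, h2⟩ := ((Filter.eventually_ge_atTop (1:ℝ)).and this).exists
    have hK0 : 0 < K := by linarith
    refine ⟨K⁻¹, by positivity, inv_le_one_of_one_le₀ h1, fun i hr => ?_⟩
    rw [Real.inv_rpow hK0.le]
    have := h2 i hr
    rw [one_div] at this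
    exact inv_le_of_inv_le₀ hδ this
  have hc1 : b * δ ≤ 1 := by nlinarith
  refine ⟨b * δ, by positivity, fun Q hQ q p hq hp => ?_⟩
  have hzero := fun hq0 => zero_case h0 (by positivity) hc1 hQ (q := q) (p := p) hq0 hp
  by_cases hq0 : q = 0
  · exact ⟨hq0, hzero hq0⟩
  exfalso
  have hQ0 : 0 < Q := by linarith
  have hH : 0 < Q / δ := by positivity
  have hH1 : 1 ≤ Q / δ := by rw [le_div_iff₀ hδ]; linarith
  obtain ⟨a₀, a, hne, ha0, ha⟩ := transfer_LM (S := {i // r i ≠ 0}) (fun i => y i) (fun i => r i)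
    (by rw [hsum r (fun _ h => h), hs]) δ ε (Q / δ) hδ hε hH hδs q (fun i => p i)
    (fun h => hq0 h.1) (by rw [mul_div_cancel₀ _ hδ.ne']; exact hq.le) (by
      rintro ⟨i, hi⟩
      refine (hp i).le.trans ?_
      have e : b * δ * Q⁻¹ = b * (Q / δ)⁻¹ := by rw [inv_div]; ring
      rw [e, Real.mul_rpow hb0.le (by positivity), Real.inv_rpow hH.le]
      exact mul_le_mul_of_nonneg_right (hb i hi) (by positivity))
  let a' : Fin n → ℤ := fun i => if hi : r i ≠ 0 then a ⟨i, hi⟩ else 0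
  have haa : ∀ i : {i // r i ≠ 0}, a' i = a i := by
    rintro ⟨i, hi⟩; simp [a', hi]
  have haz : ∀ i, r i = 0 → a' i = 0 := by
    intro i hi; simp [a', hi]
  have hfin := h (Q / δ) hH1 a₀ a' (by
      rw [← hsum (fun i => (a' i : ℝ) * y i) (fun i hi => by simp [haz i hi])]
      simp only [haa]
      refine lt_of_le_of_lt ha0 ?_
      rw [← div_eq_mul_inv]
      gcongr
      exact lt_of_lt_of_le hεm (min_le_right _ _)) (by
      intro i
      by_cases hr : r i = 0
      · rw [haz i hr, hr]; simp
      · have h1 := ha ⟨i, hr⟩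
        rw [← haa] at h1
        refine lt_of_le_of_lt h1 ?_
        have h2 : ((s : ℝ) + 1) * ε < 1 := lt_of_lt_of_le hεm (min_le_left _ _)
        have h3 : 0 < (Q / δ) ^ r i := by positivity
        exact mul_lt_of_lt_one_left h3 h2)
  exact hne ⟨hfin.1, fun i => by rw [← haa]; exact hfin.2 i⟩

theorem stmt4 (n : ℕ) (r : Fin n → ℝ) (hr : r ∈ Weights n) (y : Fin n → ℝ) :
    (y ∈ BadSet r ↔
      (∃ c : ℝ, 0 < c ∧ ∀ Q : ℝ, 1 ≤ Q → ∀ (q : ℤ) (p : Fin n → ℤ),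
        |(q : ℝ)| < Q → (∀ i, |(q : ℝ) * y i - (p i : ℝ)| < (c * Q⁻¹) ^ (r i)) →
        q = 0 ∧ ∀ i, p i = 0)) ∧
    ((∃ c : ℝ, 0 < c ∧ ∀ Q : ℝ, 1 ≤ Q → ∀ (q : ℤ) (p : Fin n → ℤ),
        |(q : ℝ)| < Q → (∀ i, |(q : ℝ) * y i - (p i : ℝ)| < (c * Q⁻¹) ^ (r i)) →
        q = 0 ∧ ∀ i, p i = 0) ↔
      (∃ c : ℝ, 0 < c ∧ ∀ H : ℝ, 1 ≤ H → ∀ (a₀ : ℤ) (a : Fin n → ℤ),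
        |(a₀ : ℝ) + ∑ i, (a i : ℝ) * y i| < c * H⁻¹ → (∀ i, |(a i : ℝ)| < H ^ (r i)) →
        a₀ = 0 ∧ ∀ i, a i = 0)) := by
  exact ⟨⟨bad_imp_II hr.2, II_imp_bad hr.2⟩, ⟨II_imp_III hr.1 hr.2, III_imp_II hr.1 hr.2⟩⟩
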